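/- Let t > 0, K > 0, let φ satisfy the smoothing conditions, and let a, b be complex numbers with a, b, a−b all nonzero and |a|, |b| sufficiently small (so that ζ(2+b−a) ≠ 0 and the only poles of s ↦ I₁₂(s,t) in the half-plane Re s > −1/2 are simple poles at s = 0, s = −a and s = −b). Then the sum of the residues of I₁₂(·,t) at s = 0, s = −a and s = −b equals −(2π/t)^{a} h(b−a)(f(−a)/a)(f(b)/b) + K^{−a} h(b−a)(G(−a)/a)(f(b−a)/(b−a)) − K^{−b}(2π/t)^{a−b} h(b−a)(G(−b)/b)(f(b−a)/(b−a)). -/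

import Mathlib

open Complex MeasureTheory Filter Finset Set
open scoped Real Topology BigOperators

noncomputable section

namespace CHN

/-- `φ` satisfies the smoothing conditions with parameter `μ`. -/
structure SmoothingFn (μ : ℝ) (φ : ℝ → ℝ) : Prop where
  smooth : ContDiff ℝ (⊤ : ℕ∞) φ
  nonneg : ∀ t : ℝ, 0 ≤ φ t
  eq_one : ∀ t : ℝ, 0 ≤ t → t ≤ 1 → φ t = 1
  eq_zero : ∀ t : ℝ, 1 + μ ≤ t → φ t = 0
  deriv_bound : ∀ j : ℕ, ∃ C : ℝ, 0 < C ∧ ∀ t : ℝ, |iteratedDeriv j φ t| ≤ C * μ⁻¹ ^ j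

/-- `ω` is an admissible weight function for `T` with parameter `ν`, support constants
`c₁ < c₂`, derivative constants `Cd`, and scale `T₀` with `T ^ ν ≤ T₀ ≪ T`. -/
structure AdmissibleWeight (c₁ c₂ ν : ℝ) (Cd : ℕ → ℝ) (T T₀ : ℝ) (ω : ℝ → ℂ) : Prop where
  hc₁ : 0 < c₁
  hc₁₂ : c₁ < c₂
  smooth : ContDiff ℝ (⊤ : ℕ∞) ω
  supp : ∀ t : ℝ, ω t ≠ 0 → c₁ * T ≤ t ∧ t ≤ c₂ * T
  hT₀_low : T ^ ν ≤ T₀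
  hT₀_high : T₀ ≤ T
  deriv_bound : ∀ (j : ℕ) (t : ℝ), ‖iteratedDeriv j ω t‖ ≤ Cd j * T₀⁻¹ ^ j

/-- The Fourier transform `ŵ(u) = ∫ ω(t) e^{-2πiut} dt`. -/
def fhat (ω : ℝ → ℂ) (u : ℝ) : ℂ :=
  ∫ t : ℝ, ω t * Complex.exp (-2 * (Real.pi : ℂ) * Complex.I * (u : ℂ) * (t : ℂ))

/-- `f(s) = s ζ(1+s)`, extended by `f(0) = 1`. -/
def fzeta (s : ℂ) : ℂ := if s = 0 then 1 else s * riemannZeta (1 + s)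

/-- `h(s) = 1/ζ(2+s)`. -/
def hzeta (s : ℂ) : ℂ := (riemannZeta (2 + s))⁻¹

/-- `H(s) = -ζ′(2+s)/ζ(2+s)²`. -/
def Hfun (s : ℂ) : ℂ := -deriv riemannZeta (2 + s) / (riemannZeta (2 + s)) ^ 2

/-- `F(s) = s² ζ′(1+s)`. -/
def Ffun (s : ℂ) : ℂ := s ^ 2 * deriv riemannZeta (1 + s)

/-- `G(s) = -2 ∫₀^∞ φ(t) φ′(t) t^s dt`. -/
def Gfun (φ : ℝ → ℝ) (s : ℂ) : ℂ :=
  -2 * ∫ t in Set.Ioi (0 : ℝ), ((φ t * deriv φ t : ℝ) : ℂ) * (t : ℂ) ^ s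

/-- `Φ₂(s) = ∫₀^∞ φ(t)² t^{s-1} dt`. -/
def Phi2 (φ : ℝ → ℝ) (s : ℂ) : ℂ :=
  ∫ t in Set.Ioi (0 : ℝ), ((φ t ^ 2 : ℝ) : ℂ) * (t : ℂ) ^ (s - 1)

/-- The Mellin transform `Φ(s) = ∫₀^∞ φ(t) t^{s-1} dt`. -/
def MellinPhi (φ : ℝ → ℝ) (s : ℂ) : ℂ :=
  ∫ t in Set.Ioi (0 : ℝ), ((φ t : ℝ) : ℂ) * (t : ℂ) ^ (s - 1)

/-- Taylor coefficients `g_j` of `f(s) = sζ(1+s)` at `s = 0`. -/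
def gcoef (j : ℕ) : ℂ := iteratedDeriv j fzeta 0 / (Nat.factorial j : ℂ)

/-- Taylor coefficients `δ_j` of `1/ζ(2+s)` at `s = 0`. -/
def dcoef (j : ℕ) : ℂ := iteratedDeriv j hzeta 0 / (Nat.factorial j : ℂ)

/-- Taylor coefficients `c_j` of `G(s)` at `s = 0`. -/
def ccoef (φ : ℝ → ℝ) (j : ℕ) : ℂ := iteratedDeriv j (Gfun φ) 0 / (Nat.factorial j : ℂ)

/-- The polynomials `Q_j(x,y)`, for `0 ≤ j ≤ 4` (and `0` for `j ≥ 5`). -/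
def Qpoly (φ : ℝ → ℝ) (j : ℕ) (x y : ℝ) : ℂ :=
  let g : ℕ → ℂ := gcoef
  let δ : ℕ → ℂ := dcoef
  let c : ℕ → ℂ := ccoef φ
  let X : ℂ := (x : ℂ)
  let Y : ℂ := (y : ℂ)
  match j with
  | 0 => 16*δ 4 - 16*δ 1*g 3 + 32*δ 3*g 1 + 32*(g 1)^2*δ 2 - 24*δ 0*g 4 + 8*(g 2)^2*δ 0
       + 5*δ 0*(g 1)^4 + 16*δ 1*(g 1)^3 - 8*δ 0*g 1*g 3 + 16*δ 1*g 1*g 2 + 12*δ 0*(g 1)^2*g 2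
       + 12*(g 1)^2*δ 1*c 1 + 12*δ 0*g 1*g 2*c 1 + 8*δ 3*c 1 + 4*δ 0*(g 1)^3*c 1 + 4*δ 0*g 3*c 1
       + 8*δ 1*g 2*c 1 + 16*g 1*δ 2*c 1 - 4*δ 2*c 2 - 6*(g 1)^2*δ 0*c 2 - 4*δ 0*g 2*c 2
       - 8*g 1*δ 1*c 2 + 4*g 1*δ 0*c 3 + 2*δ 1*c 3 - δ 0*c 4
  | 1 => (4*δ 0*g 3 + 12*δ 0*g 1*g 2 + 4*δ 0*(g 1)^3 + 8*δ 1*g 2 + 12*δ 1*(g 1)^2 + 16*δ 2*g 1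
       + 8*δ 3 - 4*c 1*δ 0*g 2 - 6*c 1*δ 0*(g 1)^2 - 8*c 1*δ 1*g 1 - 4*c 1*δ 2 + 4*c 2*δ 0*g 1
       + 2*c 2*δ 1 - c 3*δ 0) * X
       + (-12*δ 0*g 3 - 4*δ 0*g 1*g 2 - 8*δ 1*g 2 + 4*δ 1*(g 1)^2 + 4*δ 0*(g 1)^3
       + 8*c 1*δ 0*g 2 + 12*c 1*δ 0*(g 1)^2 + 16*c 1*δ 1*g 1 + 8*c 1*δ 2 - 8*c 2*δ 0*g 1
       - 4*c 2*δ 1 + 2*c 3*δ 0) * Y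
  | 2 => (-2*δ 0*g 2 - 3*δ 0*(g 1)^2 - 4*δ 1*g 1 - 2*δ 2 + 2*c 1*δ 0*g 1 + c 1*δ 1
       - c 2*δ 0/2) * X^2
       + (8*δ 0*g 2 + 12*δ 0*(g 1)^2 + 16*δ 1*g 1 + 8*δ 2 - 8*c 1*δ 0*g 1 - 4*c 1*δ 1
       + 2*c 2*δ 0) * X*Y
       + (-5*δ 0*(g 1)^2 - 4*δ 2 - 6*δ 0*g 2 - 8*δ 1*g 1 + 8*c 1*δ 0*g 1 + 4*c 1*δ 1
       - 2*c 2*δ 0) * Y^2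
  | 3 => (2*δ 0*g 1/3 + δ 1/3 - c 1*δ 0/6) * X^3 + (-4*δ 0*g 1 - 2*δ 1 + c 1*δ 0) * X^2*Y
       + (8*δ 0*g 1 + 4*δ 1 - 2*c 1*δ 0) * X*Y^2 + (-4*δ 0*g 1 - 2*δ 1 + 4*c 1*δ 0/3) * Y^3
  | 4 => (1/(24 * riemannZeta 2)) * (-X^4 + 8*X^3*Y - 24*X^2*Y^2 + 32*X*Y^3 - 14*Y^4)
  | _ => 0

/-- The smoothed Dirichlet polynomial `Σ_{n≥1} τ₂(n) n^{-1/2-it} φ(n/K)`. -/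
def tau2Poly (φ : ℝ → ℝ) (K : ℝ) (t : ℝ) : ℂ :=
  ∑' n : ℕ, ((Nat.divisors (n+1)).card : ℂ) *
    ((n+1 : ℕ) : ℂ) ^ (-(1/2 : ℂ) - Complex.I * (t : ℂ)) * ((φ (((n : ℝ)+1)/K) : ℝ) : ℂ)

/-- `D_{2,2;ω}(K) = ∫ ω(t) |Σ_{n≥1} τ₂(n) n^{-1/2-it} φ(n/K)|² dt`. -/
def D22 (φ : ℝ → ℝ) (ω : ℝ → ℂ) (K : ℝ) : ℂ :=
  ∫ t : ℝ, ω t * ((‖tau2Poly φ K t‖ ^ 2 : ℝ) : ℂ)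

/-- The shifted divisor function `σ_A(n)` for a tuple of shifts `A = (a_1, …, a_k)`. -/
def sigmaShift {k : ℕ} (a : Fin k → ℂ) (n : ℕ) : ℂ :=
  ∑ d : Fin k → Fin (n+1), if (∏ i, (d i : ℕ)) = n then ∏ i, ((d i : ℕ) : ℂ) ^ (-a i) else 0

/-- The Ramanujan sum `c_q(r) = Σ_{d ∣ (q, r)} μ(q/d) d`. -/
def ramanujanC (q : ℕ) (r : ℤ) : ℂ :=
  ∑ d ∈ (Nat.gcd q r.natAbs).divisors, ((ArithmeticFunction.moebius (q / d) : ℤ) : ℂ) * (d : ℂ)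

/-- The multiplicative function `g_A(s, n)`. -/
def gA {k : ℕ} (a : Fin k → ℂ) (s : ℂ) (n : ℕ) : ℂ :=
  ∏ p ∈ n.primeFactors,
    (∑' j : ℕ, sigmaShift a (p ^ (j + n.factorization p)) * (p : ℂ) ^ (-(j : ℂ) * s)) /
    (∑' j : ℕ, sigmaShift a (p ^ j) * (p : ℂ) ^ (-(j : ℂ) * s))

/-- The function `G_A(s, n)`. -/
def GA {k : ℕ} (a : Fin k → ℂ) (s : ℂ) (n : ℕ) : ℂ :=
  ∑ d ∈ n.divisors, ((ArithmeticFunction.moebius d : ℤ) : ℂ) * (d : ℂ) ^ s / (Nat.totient d : ℂ) *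
    ∑ e ∈ d.divisors, ((ArithmeticFunction.moebius e : ℤ) : ℂ) / (e : ℂ) ^ s * gA a s (n * e / d)

/-- The shifted convolution sum `D_{F;I,J}(r) = Σ_{m-n=r} σ_I(m) σ_J(n) F(m,n)`. -/
def DFsum {k l : ℕ} (a : Fin k → ℂ) (b : Fin l → ℂ) (F : ℝ → ℝ → ℂ) (r : ℤ) : ℂ :=
  ∑' n : ℕ, if 0 < (n : ℤ) + 1 + r then
      sigmaShift a ((n : ℤ) + 1 + r).toNat * sigmaShift b (n + 1) *
        F ((n : ℝ) + 1 + (r : ℝ)) ((n : ℝ) + 1)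
    else 0

/-- The main term in the additive divisor conjecture. -/
def ADMain {k l : ℕ} (a : Fin k → ℂ) (b : Fin l → ℂ) (F : ℝ → ℝ → ℂ) (r : ℤ) : ℂ :=
  ∑ i₁ : Fin k, ∑ i₂ : Fin l,
    (∏ j₁ ∈ Finset.univ.erase i₁, riemannZeta (1 - a i₁ + a j₁)) *
    (∏ j₂ ∈ Finset.univ.erase i₂, riemannZeta (1 - b i₂ + b j₂)) *
    (∑' q : ℕ, ramanujanC (q + 1) r * GA a (1 - a i₁) (q + 1) * GA b (1 - b i₂) (q + 1) *
        ((q + 1 : ℕ) : ℂ) ^ (a i₁ + b i₂ - 2)) *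
    ∫ x in Set.Ioi (max 0 (r : ℝ)),
      F x (x - (r : ℝ)) * (x : ℂ) ^ (-a i₁) * ((x - (r : ℝ) : ℝ) : ℂ) ^ (-b i₂)

/-- The additive divisor hypothesis `AD_{k,ℓ}(θ, C, β)`. -/
def AD (k l : ℕ) (θ C β : ℝ) : Prop :=
  ∀ ε : ℝ, 0 < ε → ∀ κ : ℝ, 1 ≤ κ → ∀ Dc : ℕ → ℕ → ℝ,
  ∃ C' : ℝ, 0 < C' ∧ ∃ X₀ : ℝ, ∀ P : ℝ, 1 < P → ∀ X Y : ℝ, X₀ ≤ X → 1/2 < Y →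
    X ≤ κ * Y → Y ≤ κ * X →
  ∀ F : ℝ → ℝ → ℂ, ContDiff ℝ (⊤ : ℕ∞) (fun p : ℝ × ℝ => F p.1 p.2) →
    (∀ x y : ℝ, F x y ≠ 0 → (X ≤ x ∧ x ≤ 2 * X) ∧ (Y ≤ y ∧ y ≤ 2 * Y)) →
    (∀ m n : ℕ, ∀ x y : ℝ,
      |x| ^ m * |y| ^ n * ‖iteratedDeriv m (fun x' => iteratedDeriv n (fun y' => F x' y') y) x‖
        ≤ Dc m n * P ^ (m + n)) →
  ∀ a : Fin k → ℂ, ∀ b : Fin l → ℂ, Function.Injective a → Function.Injective b →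
    (∀ i, ‖a i‖ ≤ κ / Real.log X) → (∀ j, ‖b j‖ ≤ κ / Real.log X) →
  ∀ r : ℤ, 1 ≤ r.natAbs → (r.natAbs : ℝ) ≤ κ * X ^ β →
    ‖DFsum a b F r - ADMain a b F r‖ ≤ C' * P ^ C * X ^ (θ + ε)

/-- The mean value `D_{I,J;ω}(K)` of long Dirichlet polynomials with shifted
divisor coefficients. -/
def DmeanShift {k l : ℕ} (a : Fin k → ℂ) (b : Fin l → ℂ) (φ : ℝ → ℝ) (ω : ℝ → ℂ)
    (K : ℝ) : ℂ :=
  ∫ t : ℝ, ω t *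
    (∑' n : ℕ, sigmaShift a (n+1) * ((n+1 : ℕ) : ℂ) ^ (-(1/2 : ℂ) - Complex.I * (t : ℂ)) *
      ((φ (((n : ℝ)+1)/K) : ℝ) : ℂ)) *
    (∑' n : ℕ, sigmaShift b (n+1) * ((n+1 : ℕ) : ℂ) ^ (-(1/2 : ℂ) + Complex.I * (t : ℂ)) *
      ((φ (((n : ℝ)+1)/K) : ℝ) : ℂ))

/-- `Z(I,J) = Π_{i,j} ζ(1 + a_i + b_j)`. -/
def Zfun {k l : ℕ} (a : Fin k → ℂ) (b : Fin l → ℂ) : ℂ :=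
  ∏ i : Fin k, ∏ j : Fin l, riemannZeta (1 + a i + b j)

/-- The Euler product `A(I,J)`. -/
def AEuler {k l : ℕ} (a : Fin k → ℂ) (b : Fin l → ℂ) : ℂ :=
  ∏' p : Nat.Primes,
    ((∏ i : Fin k, ∏ j : Fin l, (1 - ((p : ℕ) : ℂ) ^ (-(1 : ℂ) - a i - b j))) *
      ∑' u : ℕ, sigmaShift a ((p : ℕ) ^ u) * sigmaShift b ((p : ℕ) ^ u) /
        (((p : ℕ) ^ u : ℕ) : ℂ))

/-- `B(I,J) = A(I,J) Z(I,J)`. -/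
def BEuler {k l : ℕ} (a : Fin k → ℂ) (b : Fin l → ℂ) : ℂ := AEuler a b * Zfun a b

/-- The contour integral `∫_{(c)} f(s) ds`, parametrized by `s = c + iu`. -/
def lineInt (c : ℝ) (f : ℂ → ℂ) : ℂ :=
  ∫ u : ℝ, f ((c : ℂ) + (u : ℂ) * Complex.I) * Complex.I

/-- The diagonal main term `M₀(K)`. -/
def M0 {k l : ℕ} (a : Fin k → ℂ) (b : Fin l → ℂ) (φ : ℝ → ℝ) (ω : ℝ → ℂ) (K c : ℝ) : ℂ :=
  fhat ω 0 / (2 * (Real.pi : ℂ) * Complex.I) *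
    lineInt c (fun s => (K : ℂ) ^ s * Phi2 φ s * BEuler (fun i => a i + s) b)

/-- The off-diagonal main term `M₁(K)`. -/
def M1 {k l : ℕ} (a : Fin k → ℂ) (b : Fin l → ℂ) (φ : ℝ → ℝ) (ω : ℝ → ℂ) (K c : ℝ) : ℂ :=
  ∫ t in Set.Ioi (0 : ℝ), ω t *
    ∑ i : Fin k, ∑ j : Fin l,
      ((t / (2 * Real.pi) : ℝ) : ℂ) ^ (-a i - b j) *
      (∏ i' ∈ Finset.univ.erase i, riemannZeta (1 + a i' - a i)) *
      (∏ j' ∈ Finset.univ.erase j, riemannZeta (1 + b j' - b j)) *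
      ((2 * (Real.pi : ℂ) * Complex.I)⁻¹ *
        lineInt c (fun s =>
          Phi2 φ s * ((2 * Real.pi * K / t : ℝ) : ℂ) ^ s *
          (∏ i' ∈ Finset.univ.erase i, ∏ j' ∈ Finset.univ.erase j,
            riemannZeta (1 + (a i' + s) + b j')) *
          riemannZeta (1 - a i - b j - s) *
          AEuler (Function.update a i (-b j - s))
                 (Function.update (fun j' => b j' + s) j (-a i))))

end CHN

namespace CHN

/-- Euler's constant `γ₀` as a complex number. -/
def eulerγ : ℂ := (Real.eulerMascheroniConstant : ℂ)

/-- The term `R₁(a,b)` from Proposition `M₀`. -/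
def R1 (φ : ℝ → ℝ) (K : ℝ) (a b : ℂ) : ℂ :=
  ((Real.log K : ℂ) + ccoef φ 1 + eulerγ) *
      (fzeta (a+b)/(a+b)) * (fzeta a / a) * (fzeta b / b) * hzeta (a+b)
  + 2 * (fzeta (a+b)/(a+b)) * (fzeta a / a) * (fzeta b / b) * Hfun (a+b)
  + (deriv fzeta (a+b)/(a+b) - fzeta (a+b)/(a+b)^2) * (fzeta a / a) * (fzeta b / b) * hzeta (a+b)
  + (fzeta (a+b)/(a+b)) * (deriv fzeta a / a - fzeta a / a^2) * (fzeta b / b) * hzeta (a+b)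
  + (fzeta (a+b)/(a+b)) * (fzeta a / a) * (deriv fzeta b / b - fzeta b / b^2) * hzeta (a+b)

/-- The term `R₁′(a,b)`. -/
def R1' (φ : ℝ → ℝ) (K : ℝ) (a b : ℂ) : ℂ :=
  (a^2)⁻¹ * Gfun φ (-a) * (K : ℂ)^(-a) * (fzeta b / b) * (fzeta (b-a)/(b-a)) *
      fzeta (-a) * hzeta (b-a)
  + (b^2)⁻¹ * Gfun φ (-b) * (K : ℂ)^(-b) * (fzeta a / a) * (fzeta (a-b)/(a-b)) *
      fzeta (-b) * hzeta (a-b)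
  + ((a+b)^2)⁻¹ * Gfun φ (-(a+b)) * (K : ℂ)^(-(a+b)) * (fzeta (-b) / b) * (fzeta (-a) / a) *
      fzeta (-(a+b)) * hzeta (-(a+b))

/-- The term `R₂(a,b;t)`. -/
def R2 (φ : ℝ → ℝ) (K : ℝ) (a b : ℂ) (t : ℝ) : ℂ :=
  let X : ℂ := (Real.log (2 * Real.pi * K / t) : ℂ)
  let g₁ : ℂ := eulerγ
  let c₁ : ℂ := ccoef φ 1
  (-(((2*Real.pi/t : ℝ) : ℂ)^(a+b) * hzeta (-(a+b)) * (fzeta (-a)/a) * (fzeta (-b)/b) *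
      (Ffun (-(a+b))/(a+b)^2 + (fzeta (-(a+b))/(a+b)) * (X + g₁ + c₁)))
  + ((2*Real.pi/t : ℝ) : ℂ)^a * hzeta (b-a) * ((fzeta (-a))^2/a^2) * ((fzeta b)^2/b^2)
  + ((2*Real.pi/t : ℝ) : ℂ)^b * hzeta (a-b) * ((fzeta (-b))^2/b^2) * ((fzeta a)^2/a^2)
  - hzeta (a+b) * (fzeta a / a) * (fzeta b / b) *
      (Ffun (a+b)/(a+b)^2 + (fzeta (a+b)/(a+b)) * (X - g₁ + c₁))
  + (K : ℂ)^(-b) * ((2*Real.pi/t : ℝ) : ℂ)^(a-b) * hzeta (b-a) * (Gfun φ (-b)/b) *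
      (fzeta (b-a)/(b-a)) * (fzeta (-a)/a) * (fzeta b / b)
  + (K : ℂ)^(-a) * ((2*Real.pi/t : ℝ) : ℂ)^(b-a) * hzeta (a-b) * (Gfun φ (-a)/a) *
      (fzeta (a-b)/(a-b)) * (fzeta a / a) * (fzeta (-b)/b)
  - (K : ℂ)^(-(a+b)) * ((2*Real.pi/t : ℝ) : ℂ)^(-(a+b)) * hzeta (a+b) *
      (Gfun φ (-(a+b))/(a+b)) * (fzeta (a+b)/(a+b)) * (fzeta a / a) * (fzeta b / b))

/-- `I₁₁(s,t)`. -/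
def I11 (φ : ℝ → ℝ) (K : ℝ) (a b : ℂ) (s : ℂ) (t : ℝ) : ℂ :=
  (s^2)⁻¹ * Gfun φ s * (K : ℂ)^s * ((2*Real.pi/t : ℝ) : ℂ)^(a+b+s) *
    riemannZeta (1-a-b-s) * fzeta s / riemannZeta (2-a-b)

/-- `I₁₂(s,t)`. -/
def I12 (φ : ℝ → ℝ) (K : ℝ) (a b : ℂ) (s : ℂ) (t : ℝ) : ℂ :=
  s⁻¹ * Gfun φ s * (K : ℂ)^s * ((2*Real.pi/t : ℝ) : ℂ)^(a+s) *
    riemannZeta (1-a-s) * riemannZeta (1+b+s) / riemannZeta (2+b-a)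

/-- `I₂₁(s,t)`. -/
def I21 (φ : ℝ → ℝ) (K : ℝ) (a b : ℂ) (s : ℂ) (t : ℝ) : ℂ :=
  s⁻¹ * Gfun φ s * (K : ℂ)^s * ((2*Real.pi/t : ℝ) : ℂ)^(b+s) *
    riemannZeta (1-b-s) * riemannZeta (1+a+s) / riemannZeta (2+a-b)

/-- `I₂₂(s,t)`. -/
def I22 (φ : ℝ → ℝ) (K : ℝ) (a b : ℂ) (s : ℂ) (t : ℝ) : ℂ :=
  -(s^2)⁻¹ * Gfun φ s * (K : ℂ)^s * ((2*Real.pi/t : ℝ) : ℂ)^s *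
    riemannZeta (1+a+b+s) * fzeta (-s) / riemannZeta (2+a+b)

end CHN

namespace CHN

theorem fzeta_diff : Differentiable ℂ fzeta := by
  have hoff : ∀ s : ℂ, s ≠ 0 → DifferentiableAt ℂ fzeta s := by
    intro s hs
    have h1 : DifferentiableAt ℂ (fun s : ℂ => s * riemannZeta (1 + s)) s := by
      have h2 : DifferentiableAt ℂ riemannZeta (1 + s) :=
        differentiableAt_riemannZeta (by simpa using hs)
      have h3 : DifferentiableAt ℂ (fun s : ℂ => riemannZeta (1 + s)) s :=
        DifferentiableAt.comp (g := riemannZeta) (f := fun s : ℂ => 1 + s) s h2 (by fun_prop)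
      exact differentiableAt_id.mul h3
    refine h1.congr_of_eventuallyEq ?_
    filter_upwards [isOpen_ne.mem_nhds hs] with z hz
    have hz' : z ≠ 0 := hz
    simp [fzeta, hz']
  intro s
  by_cases hs : s = 0
  · subst hs
    refine (Complex.analyticAt_of_differentiable_on_punctured_nhds_of_continuousAt ?_ ?_).differentiableAt
    · filter_upwards [self_mem_nhdsWithin] with z hz using hoff z hz
    · rw [continuousAt_iff_punctured_nhds]
      have h0 : fzeta 0 = 1 := by simp [fzeta]
      rw [h0]
      have hm : Tendsto (fun s : ℂ => 1 + s) (𝓝[≠] 0) (𝓝[≠] 1) := by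
        refine tendsto_nhdsWithin_iff.2 ⟨?_, ?_⟩
        · have : Tendsto (fun s : ℂ => 1 + s) (𝓝 0) (𝓝 (1 + 0)) :=
            Continuous.tendsto (by fun_prop) 0
          rw [add_zero] at this
          exact this.mono_left nhdsWithin_le_nhds
        · filter_upwards [self_mem_nhdsWithin] with z hz
          simpa using hz
      refine (riemannZeta_residue_one.comp hm).congr' ?_
      filter_upwards [self_mem_nhdsWithin] with z hz
      have hz' : z ≠ 0 := hz
      simp [fzeta, hz']
  · exact hoff s hs

theorem deriv_zero_of_mem {μ : ℝ} {φ : ℝ → ℝ} (hφ : SmoothingFn μ φ) {t : ℝ}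
    (h0 : 0 < t) (h1 : t < 1) : deriv φ t = 0 := by
  have : φ =ᶠ[𝓝 t] fun _ => (1 : ℝ) := by
    filter_upwards [Ioo_mem_nhds h0 h1] with x hx using hφ.eq_one x hx.1.le hx.2.le
  rw [this.deriv_eq]; simp

theorem Gfun_diff {μ : ℝ} {φ : ℝ → ℝ} (hφ : SmoothingFn μ φ) : Differentiable ℂ (Gfun φ) := by
  set F : ℝ → ℂ := fun t => ((φ t * deriv φ t : ℝ) : ℂ) with hF
  have hd : Continuous (deriv φ) := hφ.smooth.continuous_deriv (by simp)
  have hc : Continuous F := Complex.continuous_ofReal.comp (hφ.smooth.continuous.mul hd)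
  have htop : F =ᶠ[atTop] fun _ => 0 := by
    filter_upwards [eventually_ge_atTop (1 + μ)] with x hx
    simp [hF, hφ.eq_zero x hx]
  have hbot : F =ᶠ[𝓝[>] 0] fun _ => 0 := by
    filter_upwards [Ioo_mem_nhdsGT (zero_lt_one (α := ℝ))] with x hx
    simp [hF, deriv_zero_of_mem hφ hx.1 hx.2]
  have hm : Differentiable ℂ (mellin F) := by
    intro s
    refine mellin_differentiableAt_of_isBigO_rpow (a := s.re + 1) (b := s.re - 1)
      (hc.locallyIntegrable.locallyIntegrableOn _) ?_ (by linarith) ?_ (by linarith)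
    · exact htop.trans_isBigO (Asymptotics.isBigO_zero _ _)
    · exact hbot.trans_isBigO (Asymptotics.isBigO_zero _ _)
  have he : Gfun φ = fun s => -2 * mellin F (s + 1) := by
    funext s
    simp only [Gfun, mellin, hF, add_sub_cancel_right, smul_eq_mul]
    congr 2
    funext x
    rw [mul_comm]
  rw [he]
  exact (hm.comp (differentiable_id.add_const 1)).const_mul _

theorem Gfun_zero {μ : ℝ} (hμ : 0 < μ) {φ : ℝ → ℝ} (hφ : SmoothingFn μ φ) : Gfun φ 0 = 1 := by
  have hd : Continuous (deriv φ) := hφ.smooth.continuous_deriv (by simp)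
  have hdf : Differentiable ℝ φ := hφ.smooth.differentiable (by simp)
  have hc : Continuous (fun t => φ t * deriv φ t) := hφ.smooth.continuous.mul hd
  have hint : IntegrableOn (fun t => φ t * deriv φ t) (Ioi 0) := by
    have hU : Ioi (0 : ℝ) = Ioc 0 (1 + μ) ∪ Ioi (1 + μ) :=
      (Ioc_union_Ioi_eq_Ioi (by linarith)).symm
    rw [hU]
    refine IntegrableOn.union (hc.integrableOn_Ioc) ?_
    refine (integrableOn_zero).congr_fun (fun x hx => ?_) measurableSet_Ioi
    simp [hφ.eq_zero x (le_of_lt hx)]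
  have key : ∫ t in Ioi (0 : ℝ), φ t * deriv φ t = 0 - φ 0 ^ 2 / 2 := by
    refine integral_Ioi_of_hasDerivAt_of_tendsto' (f := fun t => φ t ^ 2 / 2) ?_ hint ?_
    · intro x _
      have h := (((hdf x).hasDerivAt).pow 2).div_const 2
      convert! h using 1
      simp
      ring
    · refine tendsto_const_nhds.congr' ?_
      filter_upwards [eventually_ge_atTop (1 + μ)] with x hx
      simp [hφ.eq_zero x hx]
  unfold Gfun
  simp only [cpow_zero, mul_one]
  have key2 : ∫ t in Ioi (0 : ℝ), ((φ t * deriv φ t : ℝ) : ℂ) = ((0 - φ 0 ^ 2 / 2 : ℝ) : ℂ) := by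
    rw [← key]; exact integral_ofReal
  rw [key2, hφ.eq_one 0 le_rfl zero_le_one]
  norm_num

theorem res_aux (Q : ℂ → ℂ) (p : ℂ) (hQ : AnalyticAt ℂ Q p) :
    ∃ g : ℂ → ℂ, AnalyticAt ℂ g p ∧ ∀ s, s ≠ p → Q s / (s - p) = Q p / (s - p) + g s := by
  obtain ⟨P, hP⟩ := hQ
  refine ⟨dslope Q p, ⟨_, hP.has_fpower_series_dslope_fslope⟩, fun s hs => ?_⟩
  have : s - p ≠ 0 := sub_ne_zero.2 hs
  rw [dslope_of_ne _ hs, slope_def_field]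
  field_simp
  ring

/-- the sum of the residues of `I₁₂(·,t)` at its simple poles
`s = 0`, `s = -a`, `s = -b`. -/
theorem statement16
    (μ : ℝ) (hμ0 : 0 < μ) (hμ1 : μ < 1/2) (φ : ℝ → ℝ) (hφ : SmoothingFn μ φ)
    (t K : ℝ) (ht : 0 < t) (hK : 0 < K) :
    ∃ ε₀ > (0:ℝ), ∀ a b : ℂ, ‖a‖ < ε₀ → ‖b‖ < ε₀ → a ≠ 0 → b ≠ 0 → a - b ≠ 0 →
      riemannZeta (2 + b - a) ≠ 0 →
      ∃ (R₀ Ra Rb : ℂ) (g₀ ga gb : ℂ → ℂ),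
        AnalyticAt ℂ g₀ 0 ∧ AnalyticAt ℂ ga (-a) ∧ AnalyticAt ℂ gb (-b) ∧
        (∀ᶠ s in 𝓝[≠] (0:ℂ), I12 φ K a b s t = R₀/s + g₀ s) ∧
        (∀ᶠ s in 𝓝[≠] (-a), I12 φ K a b s t = Ra/(s+a) + ga s) ∧
        (∀ᶠ s in 𝓝[≠] (-b), I12 φ K a b s t = Rb/(s+b) + gb s) ∧
        R₀ + Ra + Rb =
          -(((2*Real.pi/t : ℝ) : ℂ)^a * hzeta (b-a) * (fzeta (-a)/a) * (fzeta b/b))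
          + (K : ℂ)^(-a) * hzeta (b-a) * (Gfun φ (-a)/a) * (fzeta (b-a)/(b-a))
          - (K : ℂ)^(-b) * ((2*Real.pi/t : ℝ) : ℂ)^(a-b) * hzeta (b-a) *
              (Gfun φ (-b)/b) * (fzeta (b-a)/(b-a)) := by
  have hq : ((2*Real.pi/t : ℝ) : ℂ) ≠ 0 := by
    have : (2*Real.pi/t : ℝ) ≠ 0 := by positivity
    exact_mod_cast this
  have hKc : (K : ℂ) ≠ 0 := by exact_mod_cast hK.ne'
  set q : ℂ := ((2*Real.pi/t : ℝ) : ℂ) with hqd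
  refine ⟨1, one_pos, fun a b _ _ ha hb hab _ => ?_⟩
  set P : ℂ → ℂ := fun s => Gfun φ s * (K : ℂ)^s * q^(a+s) * fzeta (-a-s) * fzeta (b+s) *
    hzeta (b-a) with hP
  have hG := Gfun_diff hφ
  have hPd : Differentiable ℂ P := by
    have h1 : Differentiable ℂ fun s : ℂ => (K : ℂ)^s :=
      differentiable_id.const_cpow (Or.inl hKc)
    have h2 : Differentiable ℂ fun s : ℂ => q^(a+s) :=
      (differentiable_id.const_add a).const_cpow (Or.inl hq)
    have h3 : Differentiable ℂ fun s : ℂ => fzeta (-a-s) :=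
      fzeta_diff.comp (differentiable_id.const_sub (-a))
    have h4 : Differentiable ℂ fun s : ℂ => fzeta (b+s) :=
      fzeta_diff.comp (differentiable_id.const_add b)
    exact ((((hG.mul h1).mul h2).mul h3).mul h4).mul_const _
  have hPa : ∀ p, AnalyticAt ℂ P p := fun p => hPd.analyticAt p
  have hI : ∀ s, s ≠ 0 → s + a ≠ 0 → s + b ≠ 0 →
      I12 φ K a b s t = -P s / (s * (s + a) * (s + b)) := by
    intro s h0 h1 h2
    have h1' : -a - s ≠ 0 := fun h => h1 (by linear_combination -h)
    have h2' : b + s ≠ 0 := by rwa [add_comm]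
    have e1 : 1 - a - s = 1 + (-a - s) := by ring
    have e2 : 1 + b + s = 1 + (b + s) := by ring
    have e3 : 2 + b - a = 2 + (b - a) := by ring
    simp only [I12, hP, fzeta, hzeta, if_neg h1', if_neg h2', e1, e2, e3, ← hqd]
    rw [eq_div_iff (by simp [h0, h1, h2])]
    field_simp
    ring
  have hba : b - a ≠ 0 := fun h => hab (by linear_combination -h)
  have ne1 : ∀ {c d : ℂ}, c + d ≠ 0 → ∀ᶠ s in 𝓝[≠] c, s + d ≠ 0 := by
    intro c d h
    have : ContinuousAt (fun s : ℂ => s + d) c := by fun_prop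
    exact (this.eventually_ne h).filter_mono nhdsWithin_le_nhds
  have ne2 : ∀ {c : ℂ}, c ≠ 0 → ∀ᶠ s in 𝓝[≠] c, s ≠ 0 := by
    intro c h
    simpa using ne1 (c := c) (d := 0) (by simpa using h)
  obtain ⟨g₀, hg₀, e₀⟩ := res_aux (fun s => -P s / ((s + a) * (s + b))) 0
    (((hPa 0).neg).div (by fun_prop) (by simp [ha, hb]))
  obtain ⟨ga, hga, ea⟩ := res_aux (fun s => -P s / (s * (s + b))) (-a)
    (((hPa _).neg).div (by fun_prop)
      (mul_ne_zero (by simpa using ha) (by rwa [neg_add_eq_sub])))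
  obtain ⟨gb, hgb, eb⟩ := res_aux (fun s => -P s / (s * (s + a))) (-b)
    (((hPa _).neg).div (by fun_prop)
      (mul_ne_zero (by simpa using hb) (by rwa [neg_add_eq_sub])))
  refine ⟨-P 0 / ((0 + a) * (0 + b)), -P (-a) / (-a * (-a + b)), -P (-b) / (-b * (-b + a)),
    g₀, ga, gb, hg₀, hga, hgb, ?_, ?_, ?_, ?_⟩
  · filter_upwards [self_mem_nhdsWithin, ne1 (c := 0) (d := a) (by simpa using ha),
      ne1 (c := 0) (d := b) (by simpa using hb)] with s h0 h1 h2
    have h0' : s ≠ 0 := h0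
    have := e₀ s h0'
    simp only [sub_zero] at this
    rw [hI s h0' h1 h2, ← this, div_div]
    congr 1; ring
  · filter_upwards [self_mem_nhdsWithin, ne2 (c := -a) (by simpa using ha),
      ne1 (c := -a) (d := b) (by rwa [neg_add_eq_sub])] with s h0 h1 h2
    have h0' : s ≠ -a := h0
    have h3 : s + a ≠ 0 := fun h => h0' (by linear_combination h)
    have := ea s h0'
    simp only [sub_neg_eq_add] at this
    rw [hI s h1 h3 h2, ← this, div_div]
    congr 1; ring
  · filter_upwards [self_mem_nhdsWithin, ne2 (c := -b) (by simpa using hb),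
      ne1 (c := -b) (d := a) (by rwa [neg_add_eq_sub])] with s h0 h1 h2
    have h0' : s ≠ -b := h0
    have h3 : s + b ≠ 0 := fun h => h0' (by linear_combination h)
    have := eb s h0'
    simp only [sub_neg_eq_add] at this
    rw [hI s h1 h2 h3, ← this, div_div]

  · have f0 : fzeta 0 = 1 := by simp [fzeta]
    have e1 : b + -a = b - a := by ring
    have e2 : -a - -b = b - a := by ring
    have e3 : a + -b = a - b := by ring
    have e4 : -a + b = b - a := by ring
    have e5 : -b + a = -(b - a) := by ring
    simp only [hP, Gfun_zero hμ0 hφ, cpow_zero, add_zero, sub_zero, zero_add, e1, e2, e3, e4, e5,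
      sub_self, add_neg_cancel, f0]
    field_simp
    ring

end CHN
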